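/- Let f ∈ F_q[x] be an irreducible polynomial of degree k, let Q = q^k, and let α be a root of f in the field F_Q with Q elements. Let g ∈ F_q[x] have degree at least one. Then for every n ≥ 0, writing g^{(n)}(x) − α for the polynomial in F_Q[x] obtained by mapping g^{(n)} into F_Q[x] and subtracting the constant α: (i) E_{f,g}(n) = ν(g^{(n)}(x) − α); (ii) e_{f,g}(n) = ν*(g^{(n)}(x) − α); (iii) M_{f,g}(n) = k·M_Q(g^{(n)}(x) − α); (iv) m_{f,g}(n) = k·m_Q(g^{(n)}(x) − α); (v) Δ_{f,g}(n) = k·Δ(g^{(n)}(x) − α); (vi) N_{f,g}(n) = N_Q(g^{(n)}(x) − α). -/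

import Mathlib

open Polynomial UniqueFactorizationMonoid
open scoped Classical

/-- The `n`-th compositional iterate of a polynomial `g`. -/
noncomputable def iterPoly {K : Type*} [CommSemiring K] (g : Polynomial K) : ℕ → Polynomial K
  | 0 => X
  | n + 1 => g.comp (iterPoly g n)

/-- `P_n[f,g] = f(g^{(n)})`. -/
noncomputable def Pn {K : Type*} [CommSemiring K] (f g : Polynomial K) (n : ℕ) : Polynomial K :=
  f.comp (iterPoly g n)

/-- The finset of (normalized) monic irreducible factors of `P`. -/
noncomputable def irrFactors {K : Type*} [Field K] (P : Polynomial K) : Finset (Polynomial K) :=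
  (normalizedFactors P).toFinset

/-- Number of distinct irreducible factors of `P`. -/
noncomputable def Nfac {K : Type*} [Field K] (P : Polynomial K) : ℕ := (irrFactors P).card

/-- Degree of the squarefree part of `P`. -/
noncomputable def Dfac {K : Type*} [Field K] (P : Polynomial K) : ℕ :=
  ∑ r ∈ irrFactors P, r.natDegree

/-- Largest degree of an irreducible factor of `P`. -/
noncomputable def Mfac {K : Type*} [Field K] (P : Polynomial K) : ℕ :=
  (irrFactors P).sup natDegree

/-- Smallest degree of an irreducible factor of `P`. -/
noncomputable def mfac {K : Type*} [Field K] (P : Polynomial K) : ℕ :=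
  sInf {d | ∃ r ∈ irrFactors P, r.natDegree = d}

/-- Largest multiplicity in the irreducible factorization of `P`. -/
noncomputable def Efac {K : Type*} [Field K] (P : Polynomial K) : ℕ :=
  (irrFactors P).sup fun r => (normalizedFactors P).count r

/-- Smallest multiplicity in the irreducible factorization of `P`. -/
noncomputable def efac {K : Type*} [Field K] (P : Polynomial K) : ℕ :=
  sInf {e | ∃ r ∈ irrFactors P, (normalizedFactors P).count r = e}

/-- Largest multiplicity of a root of `P` in an algebraic closure. -/
noncomputable def nuMax {K : Type*} [Field K] (P : Polynomial K) : ℕ :=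
  Efac (P.map (algebraMap K (AlgebraicClosure K)))

/-- Smallest multiplicity of a root of `P` in an algebraic closure. -/
noncomputable def nuMin {K : Type*} [Field K] (P : Polynomial K) : ℕ :=
  efac (P.map (algebraMap K (AlgebraicClosure K)))

/-- The pair `(f, g)` is `p`-critical: `g = a x^{p^h} + b`. -/
def IsPCritical {K : Type*} [Field K] (p : ℕ) (_f g : Polynomial K) : Prop :=
  ∃ (h : ℕ) (a b : K), g = C a * X ^ p ^ h + C b

/-- The pair `(f, g)` is critical: `f = β (x-α)^{deg f}` and `g = γ (x-α)^{deg g} + α`. -/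
def IsCritical {K : Type*} [Field K] (f g : Polynomial K) : Prop :=
  ∃ α β γ : K, f = C β * (X - C α) ^ f.natDegree ∧
    g = C γ * (X - C α) ^ g.natDegree + C α

section Algebraic

variable {F Ω : Type*} [Field F] [Field Ω] [Algebra F Ω] [Algebra.IsAlgebraic F Ω]

/-- The monic irreducible factors of `P` are the minimal polynomials of its roots. -/
theorem mem_irrFactors_iff_exists_root [IsAlgClosed Ω] {P : F[X]} (hP : P ≠ 0) {r : F[X]} :
    r ∈ irrFactors P ↔ ∃ β : Ω, aeval β P = 0 ∧ minpoly F β = r := by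
  rw [irrFactors, Multiset.mem_toFinset, mem_normalizedFactors_iff' hP]
  constructor
  · rintro ⟨hirr, hnorm, hdvd⟩
    obtain ⟨β, hβ⟩ := IsAlgClosed.exists_aeval_eq_zero Ω r hirr.degree_pos.ne'
    refine ⟨β, aeval_eq_zero_of_dvd_aeval_eq_zero hdvd hβ, ?_⟩
    refine (minpoly.eq_of_irreducible_of_monic hirr hβ ?_).symm
    rw [← hnorm]
    exact monic_normalize hirr.ne_zero
  · rintro ⟨β, hβ, rfl⟩
    have hint : IsIntegral F β := Algebra.IsIntegral.isIntegral β
    exact ⟨minpoly.irreducible hint, (minpoly.monic hint).normalize_eq_self, minpoly.dvd F β hβ⟩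

/-- Over a perfect field, the multiplicity of an irreducible factor is the multiplicity of any of
its roots in an algebraic extension. -/
theorem count_normalizedFactors_minpoly [PerfectField F] {P : F[X]} (hP : P ≠ 0) (β : Ω) :
    (normalizedFactors P).count (minpoly F β) = (P.map (algebraMap F Ω)).rootMultiplicity β := by
  have hint : IsIntegral F β := Algebra.IsIntegral.isIntegral β
  have hirr : Irreducible (minpoly F β) := minpoly.irreducible hint
  have hfin : FiniteMultiplicity (minpoly F β) P :=
    FiniteMultiplicity.of_not_isUnit hirr.not_isUnit hP
  obtain ⟨u, hu, hnd⟩ := hfin.exists_eq_pow_mul_and_not_dvd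
  set c := multiplicity (minpoly F β) P
  have hcount : (normalizedFactors P).count (minpoly F β) = c := by
    refine count_normalizedFactors_eq hirr (minpoly.monic hint).normalize_eq_self ⟨u, hu⟩ ?_
    intro h
    rw [hu, pow_succ] at h
    exact hnd ((mul_dvd_mul_iff_left (pow_ne_zero _ hirr.ne_zero)).1 h)
  have hmin : ((minpoly F β).map (algebraMap F Ω)).rootMultiplicity β = 1 := by
    refine le_antisymm ?_ ?_
    · exact rootMultiplicity_le_one_of_separable
        ((PerfectField.separable_of_irreducible hirr).map) β
    · refine (rootMultiplicity_pos (map_ne_zero hirr.ne_zero)).2 ?_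
      rw [IsRoot, eval_map_algebraMap, minpoly.aeval]
  have hroot : (u.map (algebraMap F Ω)).rootMultiplicity β = 0 := by
    refine rootMultiplicity_eq_zero fun h => hnd (minpoly.dvd F β ?_)
    rwa [IsRoot, eval_map_algebraMap] at h
  have hu0 : u ≠ 0 := by
    rintro rfl
    exact hP (by rw [hu, mul_zero])
  have hpow : ∀ c : ℕ,
      (((minpoly F β).map (algebraMap F Ω)) ^ c).rootMultiplicity β = c := by
    intro c
    rw [← count_roots, roots_pow, Multiset.count_nsmul, count_roots, hmin, mul_one]
  have hne : ((minpoly F β).map (algebraMap F Ω)) ^ c * u.map (algebraMap F Ω) ≠ 0 :=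
    mul_ne_zero (pow_ne_zero _ (map_ne_zero hirr.ne_zero)) (map_ne_zero hu0)
  rw [hcount, hu, Polynomial.map_mul, Polynomial.map_pow, rootMultiplicity_mul hne, hpow, hroot,
    add_zero]

end Algebraic

theorem natDegree_iterPoly {K : Type*} [Field K] (g : K[X]) (n : ℕ) :
    (iterPoly g n).natDegree = g.natDegree ^ n := by
  induction n with
  | zero => simp [iterPoly]
  | succ n ih => rw [iterPoly, natDegree_comp, ih, pow_succ, mul_comm]

theorem Nat.sInf_image_mul_left (k : ℕ) (s : Set ℕ) : sInf ((k * ·) '' s) = k * sInf s := by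
  rcases s.eq_empty_or_nonempty with rfl | hs
  · simp
  · refine le_antisymm (Nat.sInf_le ⟨_, Nat.sInf_mem hs, rfl⟩) ?_
    obtain ⟨d, hd, h⟩ := Nat.sInf_mem (hs.image (k * ·))
    rw [← h]
    exact Nat.mul_le_mul_left k (Nat.sInf_le hd)

section Generator

variable {K L Ω : Type*} [Field K] [Field L] [Algebra K L] [Field Ω] [Algebra K Ω] [Algebra L Ω]
  [IsScalarTower K L Ω] [FiniteDimensional K L] [Algebra.IsAlgebraic L Ω]
  {α : L} {G : K[X]}

/-- If `α` generates `L` over `K` and is a polynomial in `β`, then `K(β) = L(β)`. -/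
theorem natDegree_minpoly_of_aeval_eq_algebraMap (hα : ∀ l : L, ∃ q : K[X], aeval α q = l)
    {β : Ω} (hβ : aeval β G = algebraMap L Ω α) :
    (minpoly K β).natDegree = Module.finrank K L * (minpoly L β).natDegree := by
  have hL : IsIntegral L β := Algebra.IsIntegral.isIntegral β
  have hK : IsIntegral K β := isIntegral_trans (R := K) β hL
  have heq : (IntermediateField.adjoin L {β}).restrictScalars K =
      IntermediateField.adjoin K {β} := by
    refine le_antisymm ?_ ?_
    · have hmem : ∀ l : L, algebraMap L Ω l ∈ IntermediateField.adjoin K {β} := by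
        intro l
        obtain ⟨q, rfl⟩ := hα l
        rw [← aeval_algebraMap_apply, ← hβ, ← aeval_comp]
        exact IntermediateField.algebra_adjoin_le_adjoin K {β} (aeval_mem_adjoin_singleton K β)
      intro x hx
      have hx' : x ∈ IntermediateField.adjoin L {β} := hx
      rw [← IntermediateField.mem_toSubalgebra,
        IntermediateField.adjoin_simple_toSubalgebra_of_isAlgebraic hL.isAlgebraic,
        Algebra.adjoin_singleton_eq_range_aeval] at hx'
      obtain ⟨q, rfl⟩ := hx'
      change aeval β q ∈ _
      rw [aeval_eq_sum_range]
      refine sum_mem fun i _ => ?_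
      rw [Algebra.smul_def]
      exact mul_mem (hmem _) (pow_mem (IntermediateField.mem_adjoin_simple_self K β) _)
    · rw [IntermediateField.adjoin_simple_le_iff]
      exact IntermediateField.mem_adjoin_simple_self L β
  rw [← IntermediateField.adjoin.finrank hK, ← IntermediateField.adjoin.finrank hL, ← heq]
  exact (Module.finrank_mul_finrank K L (IntermediateField.adjoin L {β})).symm

theorem minpoly_eq_iff_of_aeval_eq_algebraMap [Normal K Ω]
    (hα : ∀ l : L, ∃ q : K[X], aeval α q = l)
    {β γ : Ω} (hβ : aeval β G = algebraMap L Ω α) (hγ : aeval γ G = algebraMap L Ω α) :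
    minpoly K β = minpoly K γ ↔ minpoly L β = minpoly L γ := by
  constructor
  · intro h
    obtain ⟨τ, hτ⟩ := (isConjRoot_iff_exists_algEquiv (K := K) (x := β) (y := γ)).1 h
    have hfix : ∀ l : L, τ (algebraMap L Ω l) = algebraMap L Ω l := by
      intro l
      obtain ⟨q, rfl⟩ := hα l
      rw [← aeval_algebraMap_apply, ← aeval_algHom_apply τ]
      have h : τ (algebraMap L Ω α) = algebraMap L Ω α := by
        rw [← hγ, ← aeval_algHom_apply τ, hτ, hβ, hγ]
      exact congrArg (aeval · q) h
    let τ' : Ω ≃ₐ[L] Ω := AlgEquiv.ofRingEquiv (f := τ.toRingEquiv) hfix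
    rw [← minpoly.algEquiv_eq τ' γ]
    congr 1
    exact hτ.symm
  · intro h
    have hdvd : minpoly L γ ∣ (minpoly K β).map (algebraMap K L) :=
      h ▸ minpoly.dvd_map_of_isScalarTower K L β
    have hγ0 : aeval γ (minpoly K β) = 0 := by
      rw [← aeval_map_algebraMap L]
      exact aeval_eq_zero_of_dvd_aeval_eq_zero hdvd (minpoly.aeval L γ)
    have hKβ : IsIntegral K β :=
      isIntegral_trans (R := K) β (Algebra.IsIntegral.isIntegral (R := L) β)
    exact minpoly.eq_of_irreducible_of_monic (minpoly.irreducible hKβ) hγ0 (minpoly.monic hKβ)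

end Generator

/-- If the monic irreducible factors of `P` and of `h` are parametrized by the same set, compatibly,
then those of `P` are the image of those of `h`. -/
theorem exists_irrFactors_eq_image {K L Ω : Type*} [Field K] [Field L] {P : K[X]} {h : L[X]}
    {S : Set Ω} {a : Ω → L[X]} {b : Ω → K[X]}
    (hP : ∀ r, r ∈ irrFactors P ↔ ∃ β ∈ S, b β = r)
    (hh : ∀ r, r ∈ irrFactors h ↔ ∃ β ∈ S, a β = r)
    (hab : ∀ β ∈ S, ∀ γ ∈ S, a β = a γ → b β = b γ) :
    ∃ φ : L[X] → K[X], irrFactors P = (irrFactors h).image φ ∧ ∀ β ∈ S, φ (a β) = b β := by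
  have hfac : Function.FactorsThrough (fun β : S => b β) (fun β : S => a β) :=
    fun β γ e => hab β β.2 γ γ.2 e
  have hφ : ∀ β ∈ S, Function.extend (fun β : S => a β) (fun β : S => b β) 0 (a β) = b β :=
    fun β hβ => hfac.extend_apply 0 ⟨β, hβ⟩
  refine ⟨_, ?_, hφ⟩
  ext r
  simp only [hP, Finset.mem_image, hh]
  constructor
  · rintro ⟨β, hβ, rfl⟩
    exact ⟨_, ⟨β, hβ, rfl⟩, hφ β hβ⟩
  · rintro ⟨_, ⟨β, hβ, rfl⟩, rfl⟩
    exact ⟨β, hβ, (hφ β hβ).symm⟩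

section Image

variable {K L : Type*} [Field K] [Field L] {P : K[X]} {h : L[X]} {φ : L[X] → K[X]}

theorem Efac_eq_of_image (himg : irrFactors P = (irrFactors h).image φ)
    (hcount : ∀ r ∈ irrFactors h,
      (normalizedFactors P).count (φ r) = (normalizedFactors h).count r) :
    Efac P = Efac h := by
  rw [Efac, Efac, himg, Finset.sup_image]
  exact Finset.sup_congr rfl hcount

theorem efac_eq_of_image (himg : irrFactors P = (irrFactors h).image φ)
    (hcount : ∀ r ∈ irrFactors h,
      (normalizedFactors P).count (φ r) = (normalizedFactors h).count r) :
    efac P = efac h := by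
  rw [efac, efac, himg]
  congr 1
  ext e
  simp only [Set.mem_ofPred_eq, Finset.exists_mem_image]
  exact exists_congr fun r => and_congr_right fun hr => by rw [hcount r hr]

variable {k : ℕ}

theorem Mfac_eq_of_image (himg : irrFactors P = (irrFactors h).image φ)
    (hdeg : ∀ r ∈ irrFactors h, (φ r).natDegree = k * r.natDegree) : Mfac P = k * Mfac h := by
  rw [Mfac, Mfac, himg, Finset.sup_image, Finset.sup_congr (f := natDegree ∘ φ) rfl hdeg]
  exact (Finset.apply_sup_eq_sup_comp_of_linearOrder (k * ·)
    (fun _ _ hab => Nat.mul_le_mul_left k hab) (mul_zero k)).symm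

theorem mfac_eq_of_image (himg : irrFactors P = (irrFactors h).image φ)
    (hdeg : ∀ r ∈ irrFactors h, (φ r).natDegree = k * r.natDegree) : mfac P = k * mfac h := by
  rw [mfac, mfac, ← Nat.sInf_image_mul_left, himg]
  congr 1
  ext d
  simp only [Set.mem_ofPred_eq, Finset.exists_mem_image, Set.mem_image, exists_exists_and_eq_and]
  exact exists_congr fun r => and_congr_right fun hr => by rw [hdeg r hr]

theorem Dfac_eq_of_image (himg : irrFactors P = (irrFactors h).image φ)
    (hinj : Set.InjOn φ (irrFactors h))
    (hdeg : ∀ r ∈ irrFactors h, (φ r).natDegree = k * r.natDegree) : Dfac P = k * Dfac h := by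
  rw [Dfac, Dfac, himg, Finset.sum_image hinj, Finset.mul_sum]
  exact Finset.sum_congr rfl hdeg

theorem Nfac_eq_of_image (himg : irrFactors P = (irrFactors h).image φ)
    (hinj : Set.InjOn φ (irrFactors h)) : Nfac P = Nfac h := by
  rw [Nfac, Nfac, himg, Finset.card_image_of_injOn hinj]

end Image

/-- A root `α` of an irreducible polynomial whose degree is `[L : K]` generates `L`. -/
theorem exists_aeval_eq_of_natDegree_eq_finrank {K L : Type*} [Field K] [Field L] [Algebra K L]
    [FiniteDimensional K L] {f : K[X]} (hf : Irreducible f)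
    (hdeg : f.natDegree = Module.finrank K L) {α : L} (hα : aeval α f = 0) (l : L) :
    ∃ q : K[X], aeval α q = l := by
  have hint : IsIntegral K α := Algebra.IsIntegral.isIntegral α
  have htop : IntermediateField.adjoin K {α} = ⊤ := by
    rw [Field.primitive_element_iff_minpoly_natDegree_eq, ← hdeg,
      ← minpoly.eq_of_irreducible hf hα, natDegree_mul_leadingCoeff_inv]
    exact hf.ne_zero
  have hl : l ∈ (IntermediateField.adjoin K {α}).toSubalgebra := by
    rw [htop]
    trivial
  rw [IntermediateField.adjoin_simple_toSubalgebra_of_isAlgebraic hint.isAlgebraic,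
    Algebra.adjoin_singleton_eq_range_aeval] at hl
  exact hl

/-- If `β` is a root of `G - α` and `α` is a simple root of `f`, then `β` has the same multiplicity
as a root of `f(G)` and of `G - α`. -/
theorem rootMultiplicity_comp {F : Type*} [Field F] {f G : F[X]} {α β : F} (hf : f.Separable)
    (hα : f.IsRoot α) (hβ : G.eval β = α) (h0 : f.comp G ≠ 0) :
    (f.comp G).rootMultiplicity β = (G - C α).rootMultiplicity β := by
  obtain ⟨u, rfl⟩ := dvd_iff_isRoot.2 hα
  have hu : u.eval α ≠ 0 := by
    intro hu
    obtain ⟨v, rfl⟩ := dvd_iff_isRoot.2 hu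
    rw [← mul_assoc] at hf
    exact (irreducible_X_sub_C α).not_isUnit (hf.of_mul_left.squarefree _ dvd_rfl)
  rw [mul_comp] at h0
  rw [mul_comp, rootMultiplicity_mul h0, sub_comp, X_comp, C_comp,
    rootMultiplicity_eq_zero (p := u.comp G), add_zero]
  rw [IsRoot, eval_comp, hβ]
  exact hu

theorem stmt11 {K L : Type*} [Field K] [Fintype K] [Field L] [Fintype L] [Algebra K L]
    (f : Polynomial K) (k : ℕ) (hf : Irreducible f) (hk : f.natDegree = k)
    (hcard : Fintype.card L = Fintype.card K ^ k)
    (α : L) (hα : aeval α f = 0)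
    (g : Polynomial K) (hg : 1 ≤ g.natDegree) (n : ℕ) :
    Efac (Pn f g n) = nuMax ((iterPoly g n).map (algebraMap K L) - C α) ∧
    efac (Pn f g n) = nuMin ((iterPoly g n).map (algebraMap K L) - C α) ∧
    Mfac (Pn f g n) = k * Mfac ((iterPoly g n).map (algebraMap K L) - C α) ∧
    mfac (Pn f g n) = k * mfac ((iterPoly g n).map (algebraMap K L) - C α) ∧
    Dfac (Pn f g n) = k * Dfac ((iterPoly g n).map (algebraMap K L) - C α) ∧
    Nfac (Pn f g n) = Nfac ((iterPoly g n).map (algebraMap K L) - C α) := by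
  have hcardpos : 1 < Fintype.card K := Fintype.one_lt_card
  have hfin : k = Module.finrank K L :=
    Nat.pow_right_injective hcardpos (hcard.symm.trans Module.card_eq_pow_finrank)
  have hgen := exists_aeval_eq_of_natDegree_eq_finrank hf (hk.trans hfin) hα
  have : Algebra.IsAlgebraic K (AlgebraicClosure L) := Algebra.IsAlgebraic.trans K L _
  have : IsAlgClosure K (AlgebraicClosure L) := ⟨inferInstance, inferInstance⟩
  have : Normal K (AlgebraicClosure L) := IsAlgClosure.normal K _
  set Ω := AlgebraicClosure L
  have hGdeg : 0 < (iterPoly g n).natDegree := by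
    rw [natDegree_iterPoly]
    exact pow_pos hg n
  rw [Pn]
  set G := iterPoly g n
  set h : L[X] := G.map (algebraMap K L) - C α with hh
  have hh0 : h ≠ 0 := by
    refine ne_zero_of_natDegree_gt (n := 0) ?_
    rwa [hh, natDegree_sub_C, natDegree_map]
  have hP0 : f.comp G ≠ 0 := by
    refine ne_zero_of_natDegree_gt (n := 0) ?_
    rw [natDegree_comp]
    exact Nat.mul_pos hf.natDegree_pos hGdeg
  have hroot : ∀ β : Ω, aeval β h = 0 ↔ aeval β G = algebraMap L Ω α := by
    intro β
    rw [hh, map_sub, aeval_map_algebraMap, aeval_C, sub_eq_zero]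
  have hfΩ : aeval (algebraMap L Ω α) f = 0 := by rw [aeval_algebraMap_apply, hα, map_zero]
  have hmemP : ∀ r, r ∈ irrFactors (f.comp G) ↔ ∃ β ∈ {β : Ω | aeval β h = 0}, minpoly K β = r := by
    intro r
    rw [mem_irrFactors_iff_exists_root (Ω := Ω) hP0]
    constructor
    · rintro ⟨β, hβ, rfl⟩
      rw [aeval_comp] at hβ
      have hconj : IsConjRoot K (algebraMap L Ω α) (aeval β G) := by
        rw [IsConjRoot, ← minpoly.eq_of_irreducible hf hβ, ← minpoly.eq_of_irreducible hf hfΩ]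
      obtain ⟨τ, hτ⟩ := hconj.exists_algEquiv
      refine ⟨τ β, ?_, minpoly.algEquiv_eq τ β⟩
      rw [Set.mem_ofPred_eq, hroot, aeval_algHom_apply τ, hτ]
    · rintro ⟨β, hβ, rfl⟩
      refine ⟨β, ?_, rfl⟩
      rw [aeval_comp, (hroot β).1 hβ, hfΩ]
  have hmemh : ∀ r, r ∈ irrFactors h ↔ ∃ β ∈ {β : Ω | aeval β h = 0}, minpoly L β = r :=
    fun r => mem_irrFactors_iff_exists_root hh0
  have hΩ0 : h.map (algebraMap L Ω) ≠ 0 := map_ne_zero hh0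
  have hmemΩ : ∀ r, r ∈ irrFactors (h.map (algebraMap L Ω)) ↔
      ∃ β ∈ {β : Ω | aeval β h = 0}, minpoly Ω β = r := by
    intro r
    rw [mem_irrFactors_iff_exists_root (Ω := Ω) hΩ0]
    simp only [aeval_map_algebraMap, Set.mem_ofPred_eq]
  have hiff : ∀ β ∈ {β : Ω | aeval β h = 0}, ∀ γ ∈ {β : Ω | aeval β h = 0},
      (minpoly K β = minpoly K γ ↔ minpoly L β = minpoly L γ) := fun β hβ γ hγ =>
    minpoly_eq_iff_of_aeval_eq_algebraMap hgen ((hroot β).1 hβ) ((hroot γ).1 hγ)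
  obtain ⟨χ, hχimg, hχ⟩ := exists_irrFactors_eq_image hmemP hmemΩ fun β _ γ _ e => by
    rw [minpoly.eq_X_sub_C', minpoly.eq_X_sub_C'] at e
    rw [C_injective (sub_right_injective e)]
  obtain ⟨φ, hφimg, hφ⟩ := exists_irrFactors_eq_image hmemP hmemh fun β hβ γ hγ =>
    (hiff β hβ γ hγ).2
  have hcount : ∀ r ∈ irrFactors (h.map (algebraMap L Ω)),
      (normalizedFactors (f.comp G)).count (χ r) =
        (normalizedFactors (h.map (algebraMap L Ω))).count r := by
    intro r hr
    obtain ⟨β, hβ, rfl⟩ := (hmemΩ r).1 hr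
    have hmap : (f.comp G).map (algebraMap K Ω) ≠ 0 := map_ne_zero hP0
    rw [hχ β hβ, count_normalizedFactors_minpoly hP0, count_normalizedFactors_minpoly hΩ0,
      Algebra.algebraMap_self, map_id]
    rw [map_comp] at hmap ⊢
    rw [rootMultiplicity_comp (α := algebraMap L Ω α)
      (PerfectField.separable_of_irreducible hf).map _ _ hmap, hh, Polynomial.map_sub, map_map,
      map_C, IsScalarTower.algebraMap_eq K L Ω]
    · rw [IsRoot, eval_map_algebraMap, hfΩ]
    · rw [eval_map_algebraMap, (hroot β).1 hβ]
  have hdeg : ∀ r ∈ irrFactors h, (φ r).natDegree = k * r.natDegree := by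
    intro r hr
    obtain ⟨β, hβ, rfl⟩ := (hmemh r).1 hr
    rw [hφ β hβ, hfin, natDegree_minpoly_of_aeval_eq_algebraMap hgen ((hroot β).1 hβ)]
  have hinj : Set.InjOn φ (irrFactors h) := by
    intro r hr s hs e
    obtain ⟨β, hβ, rfl⟩ := (hmemh r).1 hr
    obtain ⟨γ, hγ, rfl⟩ := (hmemh s).1 hs
    rw [hφ β hβ, hφ γ hγ] at e
    exact (hiff β hβ γ hγ).1 e
  exact ⟨Efac_eq_of_image hχimg hcount, efac_eq_of_image hχimg hcount,
    Mfac_eq_of_image hφimg hdeg, mfac_eq_of_image hφimg hdeg, Dfac_eq_of_image hφimg hinj hdeg,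
    Nfac_eq_of_image hφimg hinj⟩
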